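/- If a finite n-player game has a unique correlated equilibrium σ, then σ is the product distribution induced by a mixed-strategy profile that is a quasi-strict Nash equilibrium of the game. -/

import Mathlib

/-- The set of pure strategy profiles of an `n`-player game in which
player `i` has `m i` pure strategies. -/
abbrev Strat {n : ℕ} (m : Fin n → ℕ) : Type := ∀ i, Fin (m i)

/-- An `n`-player game of size `m 0 × ⋯ × m (n-1)`: player `i`'s payoff function is `G i`.
The space of such games carries the (product, i.e. Euclidean) topology. -/
abbrev Game {n : ℕ} (m : Fin n → ℕ) : Type := Fin n → Strat m → ℝ

/-- The Dirac (pure) mixed strategy concentrated on `a`. -/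
def pureStrat {k : ℕ} (a : Fin k) : Fin k → ℝ := fun b => if b = a then 1 else 0

/-- A mixed strategy profile: each player plays a probability distribution
on her pure strategies. -/
def IsMixedProfile {n : ℕ} {m : Fin n → ℕ} (σ : ∀ i, Fin (m i) → ℝ) : Prop :=
  ∀ i, (∀ a, 0 ≤ σ i a) ∧ ∑ a, σ i a = 1

/-- Multilinear extension of player `i`'s payoff to mixed strategy profiles. -/
def mixedPayoff {n : ℕ} {m : Fin n → ℕ} (G : Game m) (i : Fin n)
    (σ : ∀ j, Fin (m j) → ℝ) : ℝ :=
  ∑ s : Strat m, (∏ j, σ j (s j)) * G i s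

/-- Player `i`'s payoff when deviating to the pure strategy `t`, the others
keeping their strategies in `σ`: this is `Uⁱ(t, σ⁻ⁱ)`. -/
def devPayoff {n : ℕ} {m : Fin n → ℕ} (G : Game m) (i : Fin n)
    (σ : ∀ j, Fin (m j) → ℝ) (t : Fin (m i)) : ℝ :=
  mixedPayoff G i (Function.update σ i (pureStrat t))

/-- Nash equilibrium: no player gains by a unilateral pure deviation. -/
def IsNash {n : ℕ} {m : Fin n → ℕ} (G : Game m) (σ : ∀ i, Fin (m i) → ℝ) : Prop :=
  IsMixedProfile σ ∧ ∀ (i : Fin n) (t : Fin (m i)), devPayoff G i σ t ≤ mixedPayoff G i σ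

/-- Quasi-strictness: for every player `i`, every pure best response to `σ⁻ⁱ`
belongs to the support of `σ i`. -/
def IsQuasiStrict {n : ℕ} {m : Fin n → ℕ} (G : Game m) (σ : ∀ i, Fin (m i) → ℝ) : Prop :=
  ∀ (i : Fin n) (t : Fin (m i)),
    (∀ t' : Fin (m i), devPayoff G i σ t' ≤ devPayoff G i σ t) → 0 < σ i t

/-- A correlated strategy: a probability distribution on pure strategy profiles. -/
def IsCorrStrat {n : ℕ} {m : Fin n → ℕ} (μ : Strat m → ℝ) : Prop :=
  (∀ s, 0 ≤ μ s) ∧ ∑ s, μ s = 1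

/-- The incentive linear form
`h^{sᵢ,tᵢ}(μ) = ∑_{s : s i = sᵢ} μ s * (Uⁱ(s) - Uⁱ(tᵢ, s⁻ⁱ))`. -/
def hIC {n : ℕ} {m : Fin n → ℕ} (G : Game m) (i : Fin n) (si ti : Fin (m i))
    (μ : Strat m → ℝ) : ℝ :=
  ∑ s : Strat m, if s i = si then μ s * (G i s - G i (Function.update s i ti)) else 0

/-- A correlated equilibrium: a correlated strategy satisfying all incentive constraints. -/
def IsCorrEq {n : ℕ} {m : Fin n → ℕ} (G : Game m) (μ : Strat m → ℝ) : Prop :=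
  IsCorrStrat μ ∧ ∀ (i : Fin n) (si ti : Fin (m i)), 0 ≤ hIC G i si ti μ

open Finset in
theorem farkas_aux {J : Type} [DecidableEq J] {V : Type} [AddCommGroup V] [Module ℝ V]
    (s : Finset J) : ∀ (f : J → V →ₗ[ℝ] ℝ) (g : V →ₗ[ℝ] ℝ),
    (∀ v, (∀ j ∈ s, 0 ≤ f j v) → 0 ≤ g v) →
    ∃ y : J → ℝ, (∀ j, 0 ≤ y j) ∧ ∀ v, g v = ∑ j ∈ s, y j * f j v := by
  induction s using Finset.induction_on with
  | empty =>
    intro f g h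
    refine ⟨fun _ => 0, fun _ => le_rfl, fun v => ?_⟩
    have h1 := h v (by simp)
    have h2 := h (-v) (by simp)
    simp at h2 ⊢
    linarith
  | insert a s ha ih =>
    intro f g h
    by_cases hc : ∀ v, (∀ j ∈ s, 0 ≤ f j v) → 0 ≤ g v
    · obtain ⟨y, hy, hg⟩ := ih f g hc
      refine ⟨fun j => if j = a then 0 else y j, fun j => ?_, fun v => ?_⟩
      · dsimp only; split_ifs <;> [exact le_rfl; exact hy j]
      · rw [Finset.sum_insert ha, hg v]
        simp only [if_true, zero_mul, zero_add]
        refine Finset.sum_congr rfl fun j hj => ?_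
        rw [if_neg]
        rintro rfl
        exact ha hj
    · push Not at hc
      obtain ⟨w, hw, hgw⟩ := hc
      have hfa : f a w < 0 := by
        by_contra hcon
        push Not at hcon
        have := h w (by
          intro j hj
          rcases Finset.mem_insert.1 hj with rfl | hj
          · exact hcon
          · exact hw j hj)
        linarith
      set c : ℝ := (-(f a w))⁻¹ with hcdef
      have hcpos : 0 < c := inv_pos.2 (by linarith)
      have hcf : c * f a w = -1 := by
        rw [hcdef, inv_neg, neg_mul, inv_mul_cancel₀ hfa.ne]
      set w0 := c • w with hw0
      have hfa0 : f a w0 = -1 := by simp [hw0, hcf]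
      have hw0' : ∀ j ∈ s, 0 ≤ f j w0 := by
        intro j hj
        simp only [hw0, map_smul, smul_eq_mul]
        exact mul_nonneg hcpos.le (hw j hj)
      have hg0 : g w0 < 0 := by
        simp only [hw0, map_smul, smul_eq_mul]
        exact mul_neg_of_pos_of_neg hcpos hgw
      obtain ⟨y, hy, hg⟩ := ih (fun j => f j + (f j w0) • f a) (g + (g w0) • f a) (by
        intro v hv
        have := h (v + f a v • w0) (by
          intro j hj
          rcases Finset.mem_insert.1 hj with rfl | hj
          · simp [hfa0]
          · have := hv j hj
            simp at this ⊢
            linarith)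
        simp at this ⊢
        linarith)
      refine ⟨fun j => if j = a then (∑ j ∈ s, y j * f j w0) - g w0 else y j, fun j => ?_, fun v => ?_⟩
      · dsimp only; split_ifs
        · have : 0 ≤ ∑ j ∈ s, y j * f j w0 :=
            Finset.sum_nonneg fun j hj => mul_nonneg (hy j) (hw0' j hj)
          linarith
        · exact hy j
      · rw [Finset.sum_insert ha]
        have e : ∑ j ∈ s, (if j = a then (∑ j ∈ s, y j * f j w0) - g w0 else y j) * f j v
            = ∑ j ∈ s, y j * f j v := by
          refine Finset.sum_congr rfl fun j hj => ?_
          rw [if_neg]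
          rintro rfl
          exact ha hj
        rw [e]
        have := hg v
        simp only [LinearMap.add_apply, LinearMap.smul_apply, smul_eq_mul, mul_add,
          Finset.sum_add_distrib] at this
        simp only [if_true, sub_mul, Finset.sum_mul]
        have e2 : ∑ j ∈ s, y j * (f j w0 * f a v) = ∑ j ∈ s, y j * f j w0 * f a v :=
          Finset.sum_congr rfl fun j _ => by ring
        linarith

theorem farkas_matrix {J K : Type} [Fintype J] [Fintype K] [DecidableEq J] [DecidableEq K]
    (a : J → K → ℝ) (b : K → ℝ)
    (h : ∀ μ : K → ℝ, (∀ k, 0 ≤ μ k) → (∀ j, 0 ≤ ∑ k, μ k * a j k) → ∑ k, μ k * b k ≤ 0) :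
    ∃ y : J → ℝ, (∀ j, 0 ≤ y j) ∧ ∀ k, ∑ j, y j * a j k ≤ - b k := by
  obtain ⟨y, hy, hg⟩ := farkas_aux (V := K → ℝ) (Finset.univ : Finset (J ⊕ K))
    (Sum.elim (fun j => ∑ k, a j k • LinearMap.proj k) (fun k => LinearMap.proj k))
    (∑ k, (- b k) • LinearMap.proj k) (by
      intro v hv
      have := h v (fun k => by simpa using hv (Sum.inr k) (Finset.mem_univ _))
        (fun j => by
          have := hv (Sum.inl j) (Finset.mem_univ _)
          simp only [Sum.elim_inl, LinearMap.sum_apply, LinearMap.smul_apply, LinearMap.proj_apply,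
            smul_eq_mul] at this
          simpa only [mul_comm] using this)
      simp only [LinearMap.sum_apply, LinearMap.smul_apply, LinearMap.proj_apply,
            smul_eq_mul, neg_mul, Finset.sum_neg_distrib]
      simp only [mul_comm] at this ⊢
      linarith)
  refine ⟨fun j => y (Sum.inl j), fun j => hy _, fun k => ?_⟩
  have h1 := hg (Pi.single k 1)
  simp [LinearMap.sum_apply, Pi.single_apply] at h1
  have h2 := hy (Sum.inr k)
  linarith

/-- generator of a continuous-time chain with rates `r` -/
noncomputable def gen {m : ℕ} (r : Fin m → Fin m → ℝ) (v : Fin m → ℝ) (x : Fin m) : ℝ :=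
  ∑ t, r x t * (v t - v x)

theorem closed_argmax {m : ℕ} (r : Fin m → Fin m → ℝ) (hr : ∀ x t, 0 ≤ r x t)
    (v : Fin m → ℝ) (x : Fin m) (hx : 0 ≤ gen r v x)
    (hmax : ∀ t, 0 < r x t → v t ≤ v x) : ∀ t, 0 < r x t → v t = v x := by
  intro t ht
  have hle : ∀ s ∈ (Finset.univ : Finset (Fin m)), r x s * (v s - v x) ≤ 0 := by
    intro s _
    rcases (hr x s).eq_or_lt with h | h
    · simp [← h]
    · exact mul_nonpos_of_nonneg_of_nonpos h.le (by linarith [hmax s h])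
  have h0 : gen r v x = 0 := le_antisymm (Finset.sum_nonpos hle) hx
  have := (Finset.sum_eq_zero_iff_of_nonpos hle).1 h0 t (Finset.mem_univ _)
  rcases mul_eq_zero.1 this with h | h
  · linarith
  · linarith

theorem exists_stationary {m : ℕ} (r : Fin m → Fin m → ℝ) (hr : ∀ x t, 0 ≤ r x t)
    (A : Finset (Fin m)) (hA : A.Nonempty) (hcl : ∀ x ∈ A, ∀ t, 0 < r x t → t ∈ A) :
    ∃ p : Fin m → ℝ, (∀ x, 0 ≤ p x) ∧ ∑ x, p x = 1 ∧ (∀ x, p x ≠ 0 → x ∈ A) ∧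
      ∀ v, ∑ x, p x * gen r v x = 0 := by
  have hlin : ∀ (v : Fin m → ℝ) x, gen r v x = ∑ t, v t * gen r (Pi.single t 1) x := by
    intro v x
    have : ∀ t, v t * gen r (Pi.single t 1) x = v t * r x t - v t * (if x = t then ∑ s, r x s else 0) := by
      intro t
      unfold gen
      simp only [mul_sub, Finset.sum_sub_distrib, Pi.single_apply]
      split_ifs <;> simp
    simp only [this, Finset.sum_sub_distrib]
    unfold gen
    simp [mul_sub, Finset.mul_sum, Finset.sum_sub_distrib, mul_comm]
  by_cases h : ∀ μ : Fin m → ℝ, (∀ k, 0 ≤ μ k) →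
      (∀ j, 0 ≤ ∑ k, μ k * (if k ∈ A then gen r (Pi.single j 1) k else 0)) →
      ∑ k, μ k * (if k ∈ A then 1 else 0) ≤ 0
  · exfalso
    obtain ⟨y, hy, hy2⟩ := farkas_matrix
      (fun j k => if k ∈ A then gen r (Pi.single j 1) k else 0) (fun k => if k ∈ A then 1 else 0) h
    obtain ⟨x, hx, hmin⟩ := Finset.exists_min_image A y hA
    have h1 := hy2 x
    simp only [hx, if_true] at h1
    rw [← hlin] at h1
    have : 0 ≤ gen r y x := by
      refine Finset.sum_nonneg fun t _ => ?_
      rcases (hr x t).eq_or_lt with h | h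
      · simp [← h]
      · exact mul_nonneg h.le (by linarith [hmin t (hcl x hx t h)])
    linarith
  · push Not at h
    obtain ⟨μ, h0, h1, h2⟩ := h
    set q : Fin m → ℝ := fun k => if k ∈ A then μ k else 0 with hq
    have hqs : ∑ k, μ k * (if k ∈ A then (1:ℝ) else 0) = ∑ k, q k := by simp [hq]
    rw [hqs] at h2
    have hqg : ∀ j, 0 ≤ ∑ k, q k * gen r (Pi.single j 1) k := by
      intro j
      convert h1 j using 2 with k
      simp only [hq]; split_ifs <;> simp
    have hsum : ∑ j, ∑ k, q k * gen r (Pi.single j 1) k = 0 := by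
      rw [Finset.sum_comm]
      refine Finset.sum_eq_zero fun k _ => ?_
      rw [← Finset.mul_sum]
      have := hlin (fun _ => 1) k
      simp only [one_mul] at this
      rw [← this]
      simp [gen]
    have hz : ∀ j, ∑ k, q k * gen r (Pi.single j 1) k = 0 := fun j =>
      (Finset.sum_eq_zero_iff_of_nonneg (fun j _ => hqg j)).1 hsum j (Finset.mem_univ _)
    refine ⟨fun k => q k / ∑ k, q k, fun x => ?_, ?_, fun x hx => ?_, fun v => ?_⟩
    · refine div_nonneg ?_ h2.le
      simp only [hq]; split_ifs <;> [exact h0 x; exact le_rfl]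
    · rw [← Finset.sum_div, div_self h2.ne']
    · by_contra hc
      exact hx (by simp [hq, hc])
    · have : ∑ x, q x * gen r v x = 0 := by
        simp only [hlin v, Finset.mul_sum]
        rw [Finset.sum_comm]
        refine Finset.sum_eq_zero fun t _ => ?_
        have := hz t
        rw [← mul_zero (v t), ← this, Finset.mul_sum]
        exact Finset.sum_congr rfl fun _ _ => by ring
      simp only [div_mul_eq_mul_div]
      rw [← Finset.sum_div, this, zero_div]

theorem markov {m : ℕ} (hm : 0 < m) (r : Fin m → Fin m → ℝ) (hr : ∀ x t, 0 ≤ r x t) :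
    ∃ (k : ℕ) (p : Fin k → Fin m → ℝ), 0 < k ∧ k ≤ m ∧
      (k = m → ∀ x t, x ≠ t → r x t = 0) ∧
      (∀ c x, 0 ≤ p c x) ∧ (∀ c, ∑ x, p c x = 1) ∧
      (∀ c v, ∑ x, p c x * gen r v x = 0) ∧
      (∀ c d x, p c x ≠ 0 → p d x ≠ 0 → c = d) ∧
      (∀ v, (∀ x, 0 ≤ gen r v x) →
        (∀ c x, p c x ≠ 0 → v x = ∑ z, p c z * v z) ∧
        ∀ t, ∃ c, v t ≤ ∑ z, p c z * v z) := by
  classical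
  let Cl : Finset (Fin m) → Prop := fun A => A.Nonempty ∧ ∀ x ∈ A, ∀ t, 0 < r x t → t ∈ A
  let C := {A : Finset (Fin m) // Minimal Cl A}
  have hbelow : ∀ A, Cl A → ∃ B : C, B.1 ⊆ A := by
    intro A hA
    obtain ⟨B, hBA, hB⟩ := exists_minimal_le_of_wellFoundedLT Cl A hA
    exact ⟨⟨B, hB⟩, hBA⟩
  have hdisj : ∀ (A B : C) x, x ∈ A.1 → x ∈ B.1 → A = B := by
    intro A B x hxA hxB
    have hI : Cl (A.1 ∩ B.1) := ⟨⟨x, Finset.mem_inter.2 ⟨hxA, hxB⟩⟩, fun z hz t ht =>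
      Finset.mem_inter.2 ⟨A.2.1.2 z (Finset.mem_inter.1 hz).1 t ht,
        B.2.1.2 z (Finset.mem_inter.1 hz).2 t ht⟩⟩
    apply Subtype.ext
    apply le_antisymm
    · exact (A.2.2 hI Finset.inter_subset_left).trans Finset.inter_subset_right
    · exact (B.2.2 hI Finset.inter_subset_right).trans Finset.inter_subset_left
  choose f hf using fun A : C => A.2.1.1
  have hfinj : Function.Injective f := fun A B h => hdisj A B (f A) (hf A) (h ▸ hf B)
  choose p hp0 hp1 hpA hpst using fun A : C => exists_stationary r hr A.1 A.2.1.1 A.2.1.2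
  let e := Fintype.equivFin C
  refine ⟨Fintype.card C, fun c => p (e.symm c), ?_, ?_, ?_, fun c => hp0 _, fun c => hp1 _,
    fun c => hpst _, ?_, ?_⟩
  · obtain ⟨B, _⟩ := hbelow Finset.univ ⟨⟨⟨0, hm⟩, Finset.mem_univ _⟩, fun _ _ _ _ => Finset.mem_univ _⟩
    exact Fintype.card_pos_iff.2 ⟨B⟩
  · simpa using Fintype.card_le_of_injective f hfinj
  · intro hk x t hxt
    have hbij : Function.Bijective f := (Fintype.bijective_iff_injective_and_card f).2 ⟨hfinj, by simpa using hk⟩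
    obtain ⟨A, rfl⟩ := hbij.2 x
    by_contra hne
    have ht := A.2.1.2 _ (hf A) t (lt_of_le_of_ne (hr _ _) (Ne.symm hne))
    obtain ⟨B, rfl⟩ := hbij.2 t
    exact hxt (congrArg f (hdisj A B _ ht (hf B)))
  · intro c d x hc hd
    exact e.symm.injective (hdisj _ _ x (hpA _ _ hc) (hpA _ _ hd))
  · intro v hv
    have hconst : ∀ (A : C) x z, x ∈ A.1 → z ∈ A.1 → v x = v z := by
      intro A
      obtain ⟨w, hw, hmax⟩ := Finset.exists_max_image A.1 v A.2.1.1
      have hB : Cl (A.1.filter fun x => v x = v w) := by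
        refine ⟨⟨w, by simp [hw]⟩, fun x hx t ht => ?_⟩
        rw [Finset.mem_filter] at hx ⊢
        refine ⟨A.2.1.2 x hx.1 t ht, ?_⟩
        rw [← hx.2]
        refine closed_argmax r hr v x (hv x) (fun s hs => ?_) t ht
        rw [hx.2]
        exact hmax s (A.2.1.2 x hx.1 s hs)
      have hsub := A.2.2 hB (Finset.filter_subset _ _)
      have : ∀ x ∈ A.1, v x = v w := fun x hx => (Finset.mem_filter.1 (hsub hx)).2
      intro x z hx hz
      rw [this x hx, this z hz]
    have havg : ∀ (A : C) x, x ∈ A.1 → v x = ∑ z, p A z * v z := by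
      intro A x hx
      have : ∀ z ∈ (Finset.univ : Finset (Fin m)), p A z * v z = p A z * v x := by
        intro z _
        by_cases hz : p A z = 0
        · simp [hz]
        · rw [hconst A z x (hpA A z hz) hx]
      rw [Finset.sum_congr rfl this, ← Finset.sum_mul, hp1, one_mul]
    refine ⟨fun c x hx => havg _ x (hpA _ _ hx), fun t => ?_⟩
    obtain ⟨w, _, hmax⟩ := Finset.exists_max_image Finset.univ v ⟨t, Finset.mem_univ _⟩
    have hB : Cl (Finset.univ.filter fun x => v x = v w) := by
      refine ⟨⟨w, by simp⟩, fun x hx t ht => ?_⟩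
      rw [Finset.mem_filter] at hx ⊢
      refine ⟨Finset.mem_univ _, ?_⟩
      rw [← hx.2]
      refine closed_argmax r hr v x (hv x) (fun s hs => ?_) t ht
      rw [hx.2]
      exact hmax s (Finset.mem_univ _)
    obtain ⟨A, hA⟩ := hbelow _ hB
    refine ⟨e A, ?_⟩
    simp only [Equiv.symm_apply_apply]
    rw [← havg A (f A) (hf A), (Finset.mem_filter.1 (hA (hf A))).2]
    exact hmax t (Finset.mem_univ _)

section GameLemmas

variable {n : ℕ} {m : Fin n → ℕ}

/-- product distribution -/
noncomputable def pd (ρ : ∀ i, Fin (m i) → ℝ) : Strat m → ℝ := fun s => ∏ j, ρ j (s j)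

/-- the product of the probabilities of the players other than `i` -/
noncomputable def qd (ρ : ∀ i, Fin (m i) → ℝ) (i : Fin n) (s : Strat m) : ℝ :=
  ∏ j ∈ Finset.univ.erase i, ρ j (s j)

theorem pd_eq (ρ : ∀ i, Fin (m i) → ℝ) (i : Fin n) (s : Strat m) :
    pd ρ s = ρ i (s i) * qd ρ i s :=
  (Finset.mul_prod_erase Finset.univ (fun j => ρ j (s j)) (Finset.mem_univ i)).symm

theorem qd_update (ρ : ∀ i, Fin (m i) → ℝ) (i : Fin n) (s : Strat m) (t : Fin (m i)) :
    qd ρ i (Function.update s i t) = qd ρ i s := by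
  refine Finset.prod_congr rfl fun j hj => ?_
  rw [Function.update_of_ne (Finset.ne_of_mem_erase hj)]

theorem qd_update' (ρ : ∀ i, Fin (m i) → ℝ) (i : Fin n) (s : Strat m) (f : Fin (m i) → ℝ) :
    qd (Function.update ρ i f) i s = qd ρ i s := by
  refine Finset.prod_congr rfl fun j hj => ?_
  rw [Function.update_of_ne (Finset.ne_of_mem_erase hj)]

theorem devPayoff_eq (G : Game m) (i : Fin n) (ρ : ∀ i, Fin (m i) → ℝ) (t : Fin (m i)) :
    devPayoff G i ρ t = ∑ s : Strat m, if s i = t then qd ρ i s * G i s else 0 := by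
  unfold devPayoff mixedPayoff
  refine Finset.sum_congr rfl fun s _ => ?_
  have := pd_eq (Function.update ρ i (pureStrat t)) i s
  unfold pd at this
  rw [this, qd_update', Function.update_self]
  unfold pureStrat
  split_ifs <;> simp

theorem sum_shift (i : Fin n) (x t : Fin (m i)) (F : Strat m → ℝ) :
    (∑ s : Strat m, if s i = x then F (Function.update s i t) else 0) =
      ∑ s : Strat m, if s i = t then F s else 0 := by
  rw [← Finset.sum_filter, ← Finset.sum_filter]
  refine Finset.sum_nbij' (fun s => Function.update s i t) (fun s => Function.update s i x)
    ?_ ?_ ?_ ?_ ?_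
  · intro s _; simp
  · intro s _; simp
  · intro s hs
    have : s i = x := by simpa using hs
    simp [← this]
  · intro s hs
    have : s i = t := by simpa using hs
    simp [← this]
  · intro s _; rfl

theorem hIC_pd (G : Game m) (i : Fin n) (x t : Fin (m i)) (ρ : ∀ i, Fin (m i) → ℝ) :
    hIC G i x t (pd ρ) = ρ i x * (devPayoff G i ρ x - devPayoff G i ρ t) := by
  rw [devPayoff_eq G i ρ t, devPayoff_eq, ← sum_shift i x t (fun s => qd ρ i s * G i s),
    ← Finset.sum_sub_distrib, Finset.mul_sum]
  unfold hIC
  refine Finset.sum_congr rfl fun s _ => ?_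
  rw [qd_update]
  split_ifs with h
  · rw [pd_eq ρ i s, h]; ring
  · simp

theorem mixedPayoff_eq (G : Game m) (i : Fin n) (ρ : ∀ i, Fin (m i) → ℝ) :
    mixedPayoff G i ρ = ∑ x, ρ i x * devPayoff G i ρ x := by
  simp only [devPayoff_eq, Finset.mul_sum]
  rw [Finset.sum_comm]
  unfold mixedPayoff
  refine Finset.sum_congr rfl fun s _ => ?_
  have := pd_eq ρ i s
  unfold pd at this
  rw [this]
  simp [mul_assoc]

theorem devPayoff_update (G : Game m) (i : Fin n) (ρ : ∀ i, Fin (m i) → ℝ) (f : Fin (m i) → ℝ)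
    (t : Fin (m i)) : devPayoff G i (Function.update ρ i f) t = devPayoff G i ρ t := by
  simp [devPayoff]

theorem mixedPayoff_update (G : Game m) (i : Fin n) (ρ : ∀ i, Fin (m i) → ℝ) (f : Fin (m i) → ℝ) :
    mixedPayoff G i (Function.update ρ i f) = ∑ x, f x * devPayoff G i ρ x := by
  rw [mixedPayoff_eq]
  simp [devPayoff_update]

theorem hIC_single (G : Game m) (i : Fin n) (x t : Fin (m i)) (μ : Strat m → ℝ) :
    hIC G i x t μ = ∑ s, μ s * hIC G i x t (Pi.single s 1) := by
  have : ∀ s, hIC G i x t (Pi.single s 1) =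
      if s i = x then (G i s - G i (Function.update s i t)) else 0 := by
    intro s
    unfold hIC
    rw [Finset.sum_eq_single s]
    · simp
    · intro b _ hb
      simp [hb]
    · simp
  simp only [this]
  unfold hIC
  refine Finset.sum_congr rfl fun s _ => ?_
  split_ifs <;> simp

theorem hIC_sum {C : Type} [Fintype C] (G : Game m) (i : Fin n) (x t : Fin (m i))
    (μ : C → ℝ) (ν : C → Strat m → ℝ) :
    hIC G i x t (fun s => ∑ c, μ c * ν c s) = ∑ c, μ c * hIC G i x t (ν c) := by
  rw [hIC_single]
  simp only [fun c => hIC_single G i x t (ν c), Finset.mul_sum, Finset.sum_mul]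
  rw [Finset.sum_comm]
  simp only [mul_assoc]

/-- total weighted incentive -/
noncomputable def tot (G : Game m) (y : ∀ i, Fin (m i) → Fin (m i) → ℝ) (μ : Strat m → ℝ) : ℝ :=
  ∑ i, ∑ x, ∑ t, y i x t * hIC G i x t μ

/-- dual vectors -/
def IsDual (G : Game m) (y : ∀ i, Fin (m i) → Fin (m i) → ℝ) : Prop :=
  (∀ i x t, 0 ≤ y i x t) ∧ ∀ s, tot G y (Pi.single s 1) ≤ 0

theorem tot_single (G : Game m) (y : ∀ i, Fin (m i) → Fin (m i) → ℝ) (μ : Strat m → ℝ) :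
    tot G y μ = ∑ s, μ s * tot G y (Pi.single s 1) := by
  symm
  unfold tot
  simp only [Finset.mul_sum]
  rw [Finset.sum_comm]
  refine Finset.sum_congr rfl fun i _ => ?_
  rw [Finset.sum_comm]
  refine Finset.sum_congr rfl fun x _ => ?_
  rw [Finset.sum_comm]
  refine Finset.sum_congr rfl fun t _ => ?_
  rw [hIC_single, Finset.mul_sum]
  exact Finset.sum_congr rfl fun s _ => by ring

theorem tot_pd (G : Game m) (y : ∀ i, Fin (m i) → Fin (m i) → ℝ) (ρ : ∀ i, Fin (m i) → ℝ) :
    tot G y (pd ρ) = - ∑ i, ∑ x, ρ i x * gen (y i) (devPayoff G i ρ) x := by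
  unfold tot gen
  rw [← Finset.sum_neg_distrib]
  refine Finset.sum_congr rfl fun i _ => ?_
  rw [← Finset.sum_neg_distrib]
  refine Finset.sum_congr rfl fun x _ => ?_
  rw [Finset.mul_sum, ← Finset.sum_neg_distrib]
  refine Finset.sum_congr rfl fun t _ => ?_
  rw [hIC_pd]; ring

/-- invariance of a profile under rates -/
def InvProf (y : ∀ i, Fin (m i) → Fin (m i) → ℝ) (ρ : ∀ i, Fin (m i) → ℝ) : Prop :=
  ∀ i v, ∑ x, ρ i x * gen (y i) v x = 0

theorem tot_pd_update (G : Game m) (y : ∀ i, Fin (m i) → Fin (m i) → ℝ)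
    (ρ : ∀ i, Fin (m i) → ℝ) (hρ : InvProf y ρ) (i : Fin n) (x : Fin (m i)) :
    tot G y (pd (Function.update ρ i (pureStrat x))) = - gen (y i) (devPayoff G i ρ) x := by
  rw [tot_pd, Finset.sum_eq_single i]
  · have : devPayoff G i (Function.update ρ i (pureStrat x)) = devPayoff G i ρ :=
      funext fun t => devPayoff_update G i ρ _ t
    rw [this]
    simp [pureStrat]
  · intro j _ hj
    rw [Function.update_of_ne hj]
    exact hρ j _
  · simp

theorem pureStrat_mixed {k : ℕ} (x : Fin k) : (∀ a, 0 ≤ pureStrat x a) ∧ ∑ a, pureStrat x a = 1 := by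
  refine ⟨fun a => ?_, by simp [pureStrat]⟩
  unfold pureStrat; split_ifs <;> norm_num

theorem update_mixed {ρ : ∀ i, Fin (m i) → ℝ} (hρ : IsMixedProfile ρ) (i : Fin n) (x : Fin (m i)) :
    IsMixedProfile (Function.update ρ i (pureStrat x)) := by
  intro j
  by_cases h : j = i
  · subst h; rw [Function.update_self]; exact pureStrat_mixed x
  · rw [Function.update_of_ne h]; exact hρ j

theorem pd_nonneg {ρ : ∀ i, Fin (m i) → ℝ} (hρ : IsMixedProfile ρ) (s) : 0 ≤ pd ρ s :=
  Finset.prod_nonneg fun j _ => (hρ j).1 _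

theorem sum_pd (ρ : ∀ i, Fin (m i) → ℝ) : ∑ s : Strat m, pd ρ s = ∏ i, ∑ x, ρ i x := by
  unfold pd
  rw [Finset.prod_univ_sum]
  simp

theorem pd_corr {ρ : ∀ i, Fin (m i) → ℝ} (hρ : IsMixedProfile ρ) : IsCorrStrat (pd ρ) := by
  refine ⟨pd_nonneg hρ, ?_⟩
  rw [sum_pd]
  exact Finset.prod_eq_one fun i _ => (hρ i).2

theorem subharmonic (G : Game m) (y : ∀ i, Fin (m i) → Fin (m i) → ℝ) (hy : IsDual G y)
    (ρ : ∀ i, Fin (m i) → ℝ) (hm : IsMixedProfile ρ) (hρ : InvProf y ρ) (i : Fin n) (x : Fin (m i)) :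
    0 ≤ gen (y i) (devPayoff G i ρ) x := by
  have h1 := tot_pd_update G y ρ hρ i x
  have h2 : tot G y (pd (Function.update ρ i (pureStrat x))) ≤ 0 := by
    rw [tot_single]
    exact Finset.sum_nonpos fun s _ =>
      mul_nonpos_of_nonneg_of_nonpos (pd_nonneg (update_mixed hm i x) s) (hy.2 s)
  linarith

/-- marginals -/
theorem marginal {ρ : ∀ i, Fin (m i) → ℝ} (hρ : IsMixedProfile ρ) (i : Fin n) (x : Fin (m i)) :
    (∑ s : Strat m, if s i = x then pd ρ s else 0) = ρ i x := by
  have h1 := mixedPayoff_eq (fun _ _ => 1 : Game m) i (Function.update ρ i (pureStrat x))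
  have h2 : ∀ s : Strat m, (if s i = x then pd ρ s else 0) =
      ρ i x * pd (Function.update ρ i (pureStrat x)) s := by
    intro s
    rw [pd_eq ρ i, pd_eq (Function.update ρ i (pureStrat x)) i, qd_update', Function.update_self]
    unfold pureStrat
    split_ifs with h
    · rw [h]; ring
    · simp
  simp only [h2]
  rw [← Finset.mul_sum, (pd_corr (update_mixed hρ i x)).2, mul_one]

theorem pd_injective {ρ τ : ∀ i, Fin (m i) → ℝ} (hρ : IsMixedProfile ρ) (hτ : IsMixedProfile τ)
    (h : pd ρ = pd τ) : ρ = τ := by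
  funext i x
  rw [← marginal hρ, ← marginal hτ, h]

/-- Dual reduction. -/
theorem reduction (hm : ∀ i, 0 < m i) (G : Game m)
    (hsub : ∀ μ ν, IsCorrEq G μ → IsCorrEq G ν → μ = ν)
    (y : ∀ i, Fin (m i) → Fin (m i) → ℝ) (hy : IsDual G y) :
    ∃ (k : Fin n → ℕ) (H : Game k), (∀ i, 0 < k i) ∧ (∀ i, k i ≤ m i) ∧
      ((∀ i, k i = m i) → ∀ i x t, x ≠ t → y i x t = 0) ∧
      (∀ μ ν, IsCorrEq H μ → IsCorrEq H ν → μ = ν) ∧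
      ((∃ ρ, IsMixedProfile ρ ∧ IsCorrEq H (pd ρ)) →
        ∃ τ, IsMixedProfile τ ∧ IsCorrEq G (pd τ) ∧ InvProf y τ) := by
  choose k p hk0 hkm hkeq hp0 hp1 hpinv hpdisj hpv using fun i => markov (hm i) (y i) (hy.1 i)
  let π : Strat k → ∀ i, Fin (m i) → ℝ := fun c i => p i (c i)
  have hπm : ∀ c, IsMixedProfile (π c) := fun c i => ⟨hp0 i _, hp1 i _⟩
  have hπinv : ∀ c, InvProf y (π c) := fun c i => hpinv i _
  let H : Game k := fun i c => mixedPayoff G i (π c)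
  have hπup : ∀ c i b, π (Function.update c i b) = Function.update (π c) i (p i b) := by
    intro c i b
    funext j
    by_cases h : j = i
    · subst h; simp [π]
    · simp [π, h]
  let bar : (Strat k → ℝ) → Strat m → ℝ := fun μ s => ∑ c, μ c * pd (π c) s
  have hbar : ∀ μ, IsCorrEq H μ → IsCorrEq G (bar μ) := by
    intro μ hμ
    refine ⟨⟨fun s => Finset.sum_nonneg fun c _ => mul_nonneg (hμ.1.1 c) (pd_nonneg (hπm c) s), ?_⟩, ?_⟩
    · simp only [bar]
      rw [Finset.sum_comm]
      simp only [← Finset.mul_sum, (pd_corr (hπm _)).2, mul_one]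
      exact hμ.1.2
    · intro i x t
      simp only [bar]
      rw [hIC_sum]
      simp only [hIC_pd]
      by_cases hx : ∃ a, p i a x ≠ 0
      · obtain ⟨a, ha⟩ := hx
        let v : Fin (m i) → ℝ := fun z => ∑ c : Strat k, (if c i = a then μ c else 0) * devPayoff G i (π c) z
        have e1 : ∑ c, μ c * (π c i x * (devPayoff G i (π c) x - devPayoff G i (π c) t))
            = p i a x * (v x - v t) := by
          simp only [v]
          rw [← Finset.sum_sub_distrib, Finset.mul_sum]
          refine Finset.sum_congr rfl fun c _ => ?_
          by_cases hc : c i = a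
          · simp only [π, hc, if_true]; ring
          · have : p i (c i) x = 0 := by
              by_contra hne
              exact hc (hpdisj i _ _ x hne ha)
            simp [π, hc, this]
        rw [e1]
        refine mul_nonneg (hp0 i a x) ?_
        have hv : ∀ z, 0 ≤ gen (y i) v z := by
          intro z
          have : gen (y i) v z = ∑ c : Strat k, (if c i = a then μ c else 0) *
              gen (y i) (devPayoff G i (π c)) z := by
            simp only [gen, v, ← Finset.sum_sub_distrib, Finset.mul_sum]
            rw [Finset.sum_comm]
            exact Finset.sum_congr rfl fun _ _ => Finset.sum_congr rfl fun _ _ => by ring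
          rw [this]
          refine Finset.sum_nonneg fun c _ => mul_nonneg ?_ (subharmonic G y hy _ (hπm c) (hπinv c) i z)
          split_ifs <;> [exact hμ.1.1 c; exact le_rfl]
        obtain ⟨hv1, hv2⟩ := hpv i v hv
        obtain ⟨b, hb⟩ := hv2 t
        have hxa := hv1 a x ha
        have hab := hμ.2 i a b
        have e2 : hIC H i a b μ = ∑ z, p i a z * v z - ∑ z, p i b z * v z := by
          have e3 : ∀ d, ∑ z, p i d z * v z = ∑ c : Strat k, (if c i = a then μ c else 0) *
              mixedPayoff G i (Function.update (π c) i (p i d)) := by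
            intro d
            simp only [mixedPayoff_update, v, Finset.mul_sum]
            rw [Finset.sum_comm]
            exact Finset.sum_congr rfl fun _ _ => Finset.sum_congr rfl fun _ _ => by ring
          rw [e3, e3, ← Finset.sum_sub_distrib]
          unfold hIC
          refine Finset.sum_congr rfl fun c _ => ?_
          split_ifs with hc
          · simp only [H]
            rw [← hπup, ← hπup, ← hc, Function.update_eq_self]
            ring
          · simp
        linarith
      · push Not at hx
        refine (Finset.sum_eq_zero fun c _ => ?_).ge
        simp [π, hx]
  refine ⟨k, H, hk0, hkm, fun h i => hkeq i (h i), ?_, ?_⟩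
  · intro μ ν hμ hν
    have hb := hsub _ _ (hbar μ hμ) (hbar ν hν)
    have hex : ∀ i a, ∃ x, p i a x ≠ 0 := by
      intro i a
      by_contra hc
      push Not at hc
      have := hp1 i a
      simp [hc] at this
    choose f hf using hex
    funext c
    have key : ∀ μ, bar μ (fun i => f i (c i)) = μ c * pd (π c) (fun i => f i (c i)) := by
      intro μ
      simp only [bar]
      refine Finset.sum_eq_single c (fun d _ hd => ?_) (by simp)
      obtain ⟨i, hi⟩ := Function.ne_iff.1 hd
      have : pd (π d) (fun i => f i (c i)) = 0 := by
        refine Finset.prod_eq_zero (Finset.mem_univ i) ?_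
        by_contra hne
        exact hi (hpdisj i _ _ _ hne (hf i (c i)))
      rw [this, mul_zero]
    have hne : pd (π c) (fun i => f i (c i)) ≠ 0 :=
      Finset.prod_ne_zero_iff.2 fun i _ => hf i (c i)
    have := congrFun hb (fun i => f i (c i))
    rw [key, key] at this
    exact mul_right_cancel₀ hne this
  · rintro ⟨ρ, hρ, hce⟩
    let τ : ∀ i, Fin (m i) → ℝ := fun i x => ∑ a, ρ i a * p i a x
    have hτ : bar (pd ρ) = pd τ := by
      funext s
      simp only [bar, pd, τ, π]
      rw [Finset.prod_univ_sum]
      simp [Finset.prod_mul_distrib]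
    refine ⟨τ, fun i => ⟨fun x => Finset.sum_nonneg fun a _ => mul_nonneg ((hρ i).1 a) (hp0 i a x), ?_⟩,
      hτ ▸ hbar _ hce, fun i v => ?_⟩
    · simp only [τ]
      rw [Finset.sum_comm]
      simp only [← Finset.mul_sum, hp1, mul_one]
      exact (hρ i).2
    · simp only [τ, Finset.sum_mul]
      rw [Finset.sum_comm]
      refine Finset.sum_eq_zero fun a _ => ?_
      simp only [mul_assoc]
      rw [← Finset.mul_sum, hpinv, mul_zero]

/-- normalization -/
theorem normalize_ce (G : Game m) (μ : Strat m → ℝ) (h0 : ∀ s, 0 ≤ μ s) (hpos : 0 < ∑ s, μ s)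
    (h : ∀ i x t, 0 ≤ hIC G i x t μ) : IsCorrEq G (fun s => (∑ s, μ s)⁻¹ * μ s) := by
  refine ⟨⟨fun s => mul_nonneg (inv_pos.2 hpos).le (h0 s), ?_⟩, fun i x t => ?_⟩
  · rw [← Finset.mul_sum, inv_mul_cancel₀ hpos.ne']
  · have := hIC_sum (C := Unit) G i x t (fun _ => (∑ s, μ s)⁻¹) (fun _ => μ)
    simp only [Finset.univ_unique, Finset.sum_singleton] at this
    rw [this]
    exact mul_nonneg (inv_pos.2 hpos).le (h i x t)

theorem farkas_game (G : Game m) (b : Strat m → ℝ)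
    (h : ∀ μ : Strat m → ℝ, (∀ s, 0 ≤ μ s) → (∀ i x t, 0 ≤ hIC G i x t μ) → ∑ s, μ s * b s ≤ 0) :
    ∃ y : ∀ i, Fin (m i) → Fin (m i) → ℝ, (∀ i x t, 0 ≤ y i x t) ∧
      ∀ s, tot G y (Pi.single s 1) ≤ - b s := by
  obtain ⟨y, hy, hys⟩ := farkas_matrix (J := Σ i, Fin (m i) × Fin (m i))
    (fun j s => hIC G j.1 j.2.1 j.2.2 (Pi.single s 1)) b (fun μ h0 h1 => h μ h0 fun i x t => by
      rw [hIC_single]; exact h1 ⟨i, x, t⟩)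
  refine ⟨fun i x t => y ⟨i, x, t⟩, fun i x t => hy _, fun s => ?_⟩
  convert hys s using 1
  unfold tot
  rw [Fintype.sum_sigma]
  refine Finset.sum_congr rfl fun i _ => ?_
  rw [Fintype.sum_prod_type]

theorem exists_dual_or_strict (G : Game m) :
    (∃ y, IsDual G y ∧ ∃ i x t, x ≠ t ∧ y i x t ≠ 0) ∨
    ∃ μ : Strat m → ℝ, (∀ s, 0 ≤ μ s) ∧ (∀ i x t, 0 ≤ hIC G i x t μ) ∧
      ∀ i x t, x ≠ t → 0 < hIC G i x t μ := by
  by_cases h : ∃ i x t, x ≠ t ∧ ∀ μ : Strat m → ℝ, (∀ s, 0 ≤ μ s) → (∀ i x t, 0 ≤ hIC G i x t μ) →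
      hIC G i x t μ ≤ 0
  · left
    obtain ⟨i, x, t, hxt, h⟩ := h
    obtain ⟨y, hy, hys⟩ := farkas_game G (fun s => hIC G i x t (Pi.single s 1)) (by
      intro μ h0 h1
      rw [← hIC_single]
      exact h μ h0 h1)
    let e : ∀ j, Fin (m j) → Fin (m j) → ℝ := fun j a b =>
      if (⟨j, a, b⟩ : Σ j, Fin (m j) × Fin (m j)) = ⟨i, x, t⟩ then 1 else 0
    have he : ∀ j a b, 0 ≤ e j a b := by
      intro j a b; simp only [e]; split_ifs <;> norm_num
    have hei : e i x t = 1 := by simp [e]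
    refine ⟨fun j a b => y j a b + e j a b, ⟨fun j a b => add_nonneg (hy j a b) (he j a b), fun s => ?_⟩,
      i, x, t, hxt, ?_⟩
    · have h1 : tot G e (Pi.single s 1) = hIC G i x t (Pi.single s 1) := by
        have : tot G e (Pi.single s 1) = ∑ q : Σ j, Fin (m j) × Fin (m j),
            if q = ⟨i, x, t⟩ then hIC G q.1 q.2.1 q.2.2 (Pi.single s 1) else 0 := by
          unfold tot
          rw [Fintype.sum_sigma]
          refine Finset.sum_congr rfl fun j _ => ?_
          rw [Fintype.sum_prod_type]
          refine Finset.sum_congr rfl fun a _ => Finset.sum_congr rfl fun b _ => ?_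
          simp only [e, ite_mul, one_mul, zero_mul]
        rw [this]
        simp
      have h2 : tot G (fun j a b => y j a b + e j a b) (Pi.single s 1) =
          tot G y (Pi.single s 1) + tot G e (Pi.single s 1) := by
        unfold tot
        simp only [add_mul, Finset.sum_add_distrib]
      rw [h2, h1]
      linarith [hys s]
    · have := hy i x t
      show y i x t + e i x t ≠ 0
      rw [hei]; linarith
  · right
    push Not at h
    choose μ h0 h1 h2 using h
    classical
    let Q := {q : Σ j, Fin (m j) × Fin (m j) // q.2.1 ≠ q.2.2}
    let ν : Q → Strat m → ℝ := fun q => μ q.1.1 q.1.2.1 q.1.2.2 q.2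
    have key := fun i x t => hIC_sum G i x t (fun _ : Q => 1) ν
    refine ⟨fun s => ∑ q : Q, 1 * ν q s, fun s => Finset.sum_nonneg fun q _ => ?_, fun i x t => ?_,
      fun i x t hxt => ?_⟩
    · simpa using h0 _ _ _ _ _
    · rw [key]
      exact Finset.sum_nonneg fun q _ => by simpa using h1 _ _ _ _ _ _ _
    · rw [key]
      refine Finset.sum_pos' (fun q _ => by simpa using h1 _ _ _ _ _ _ _)
        ⟨⟨⟨i, x, t⟩, hxt⟩, Finset.mem_univ _, ?_⟩
      simpa using h2 i x t hxt

theorem strict_case (hm : ∀ i, 0 < m i) (G : Game m)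
    (hsub : ∀ μ ν, IsCorrEq G μ → IsCorrEq G ν → μ = ν)
    (μ : Strat m → ℝ) (h0 : ∀ s, 0 ≤ μ s) (h1 : ∀ i x t, 0 ≤ hIC G i x t μ)
    (h2 : ∀ i x t, x ≠ t → 0 < hIC G i x t μ) : ∀ i (x t : Fin (m i)), x = t := by
  intro i x t
  by_contra hxt
  -- every Dirac mass can be mixed in
  have hb : ∀ s : Strat m, ∃ N : ℝ, 0 < N ∧ ∀ j a b, 0 ≤ N * hIC G j a b μ + hIC G j a b (Pi.single s 1) := by
    intro s
    have : ∀ q : Σ j, Fin (m j) × Fin (m j), ∃ N : ℝ, 0 < N ∧ ∀ M, N ≤ M →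
        0 ≤ M * hIC G q.1 q.2.1 q.2.2 μ + hIC G q.1 q.2.1 q.2.2 (Pi.single s 1) := by
      rintro ⟨j, a, b⟩
      by_cases hab : a = b
      · subst hab
        refine ⟨1, one_pos, fun M hM => ?_⟩
        have : hIC G j a a (Pi.single s 1) = 0 := by
          unfold hIC
          refine Finset.sum_eq_zero fun s' _ => ?_
          split_ifs with h
          · rw [← h]; simp
          · rfl
        dsimp only
        rw [this, add_zero]
        exact mul_nonneg (by linarith) (h1 _ _ _)
      · have hp := h2 j a b hab
        refine ⟨|hIC G j a b (Pi.single s 1)| / hIC G j a b μ + 1, by positivity, fun M hM => ?_⟩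
        dsimp only
        have : |hIC G j a b (Pi.single s 1)| / hIC G j a b μ ≤ M := by linarith
        rw [div_le_iff₀ hp] at this
        linarith [neg_abs_le (hIC G j a b (Pi.single s 1))]
    choose N hN hNM using this
    refine ⟨1 + ∑ q, N q, ?_, fun j a b => hNM ⟨j, a, b⟩ _ ?_⟩
    · have : 0 ≤ ∑ q, N q := Finset.sum_nonneg fun q _ => (hN q).le
      linarith
    · have := Finset.single_le_sum (f := N) (fun q _ => (hN q).le) (Finset.mem_univ ⟨j, a, b⟩)
      linarith
  have hspos : 0 < ∑ s, μ s := by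
    refine lt_of_le_of_ne (Finset.sum_nonneg fun s _ => h0 s) fun hz => ?_
    have hz' := (Finset.sum_eq_zero_iff_of_nonneg (fun s _ => h0 s)).1 hz.symm
    have := h2 i x t hxt
    rw [hIC_single] at this
    simp [hz'] at this
  have hμ := normalize_ce G μ h0 hspos h1
  -- the normalize_ced equilibrium is each Dirac mass
  have hdir : ∀ s : Strat m, ∀ s', (∑ s, μ s)⁻¹ * μ s' = (Pi.single s 1 : Strat m → ℝ) s' := by
    intro s s'
    obtain ⟨N, hN, hNM⟩ := hb s
    set T := ∑ s, μ s with hT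
    have e0 : ∑ s', (N * μ s' + (Pi.single s 1 : Strat m → ℝ) s') = N * T + 1 := by
      rw [Finset.sum_add_distrib, ← Finset.mul_sum]; simp [hT]
    have hpos : 0 < N * T + 1 := by positivity
    have h3 := normalize_ce G (fun s' => N * μ s' + (Pi.single s 1 : Strat m → ℝ) s')
      (fun s' => add_nonneg (mul_nonneg hN.le (h0 s')) (by
        rw [Pi.single_apply]; split_ifs <;> norm_num)) (by rw [e0]; exact hpos)
      (fun j a b => by
        have := hIC_sum G j a b ![N, 1] ![μ, Pi.single s 1]
        simp only [Fin.sum_univ_two, Matrix.cons_val_zero, Matrix.cons_val_one, one_mul] at this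
        rw [this]
        exact hNM j a b)
    have h4 := congrFun (hsub _ _ hμ h3) s'
    simp only [e0] at h4
    rw [inv_mul_eq_div, inv_mul_eq_div, div_eq_div_iff hspos.ne' hpos.ne'] at h4
    rw [inv_mul_eq_div, div_eq_iff hspos.ne']
    linarith
  let s0 : Strat m := fun j => ⟨0, hm j⟩
  have a1 := hdir (Function.update s0 i x) (Function.update s0 i x)
  have a2 := hdir (Function.update s0 i t) (Function.update s0 i x)
  rw [a1] at a2
  have hne : Function.update s0 i x ≠ Function.update s0 i t := by
    intro h
    have := congrFun h i
    simp at this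
    exact hxt this
  simp [Pi.single_apply, hne] at a2

end GameLemmas

theorem exists_product_aux (N : ℕ) : ∀ {n : ℕ} (m : Fin n → ℕ) (_ : ∑ i, m i = N)
    (_ : ∀ i, 0 < m i) (G : Game m)
    (_ : ∀ μ ν, IsCorrEq G μ → IsCorrEq G ν → μ = ν),
    ∃ ρ, IsMixedProfile ρ ∧ IsCorrEq G (pd ρ) := by
  induction N using Nat.strong_induction_on with
  | _ N ih =>
    intro n m hN hm G hsub
    rcases exists_dual_or_strict G with ⟨y, hy, i, x, t, hxt, hne⟩ | ⟨μ, h0, h1, h2⟩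
    · obtain ⟨k, H, hk0, hkm, hkeq, hHsub, hlift⟩ := reduction hm G hsub y hy
      have hlt : ∑ i, k i < N := by
        rw [← hN]
        refine lt_of_le_of_ne (Finset.sum_le_sum fun i _ => hkm i) fun he => ?_
        have := (Finset.sum_eq_sum_iff_of_le (fun i _ => hkm i)).1 he
        exact hne (hkeq (fun i => this i (Finset.mem_univ _)) i x t hxt)
      obtain ⟨τ, h, h', _⟩ := hlift (ih _ hlt k rfl hk0 H hHsub)
      exact ⟨τ, h, h'⟩
    · have hs := strict_case hm G hsub μ h0 h1 h2
      have hmx : IsMixedProfile (fun i => pureStrat (⟨0, hm i⟩ : Fin (m i))) := fun i => pureStrat_mixed _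
      refine ⟨fun i => pureStrat ⟨0, hm i⟩, hmx, pd_corr hmx, fun i x t => ?_⟩
      rw [hIC_pd, hs i x t]
      simp

theorem statement4 {n : ℕ} (m : Fin n → ℕ) (hm : ∀ i, 0 < m i) (G : Game m)
    (σ : Strat m → ℝ) (hσ : IsCorrEq G σ) (huniq : ∀ μ, IsCorrEq G μ → μ = σ) :
    ∃ τ : ∀ i, Fin (m i) → ℝ, IsNash G τ ∧ IsQuasiStrict G τ ∧
      σ = fun s : Strat m => ∏ j, τ j (s j) := by
  have hsub : ∀ μ ν, IsCorrEq G μ → IsCorrEq G ν → μ = ν := fun μ ν h1 h2 =>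
    (huniq μ h1).trans (huniq ν h2).symm
  obtain ⟨τ, hτ, hce⟩ := exists_product_aux _ m rfl hm G hsub
  have hinv : ∀ y, IsDual G y → InvProf y τ := by
    intro y hy
    obtain ⟨k, H, hk0, hkm, hkeq, hHsub, hlift⟩ := reduction hm G hsub y hy
    obtain ⟨τ', h, h', hi⟩ := hlift (exists_product_aux _ k rfl hk0 H hHsub)
    rwa [pd_injective hτ h (hsub _ _ hce h')]
  refine ⟨τ, ⟨hτ, fun i t => ?_⟩, fun i t hbr => ?_, (huniq _ hce).symm⟩
  · have h1 : ∀ x, 0 ≤ τ i x * (devPayoff G i τ x - devPayoff G i τ t) := fun x => by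
      rw [← hIC_pd]; exact hce.2 i x t
    have h2 := Finset.sum_nonneg fun x (_ : x ∈ Finset.univ) => h1 x
    simp only [mul_sub, Finset.sum_sub_distrib, ← Finset.sum_mul, (hτ i).2, one_mul] at h2
    rw [mixedPayoff_eq]
    linarith
  · by_contra hcon
    have hz : τ i t = 0 := le_antisymm (not_lt.1 hcon) ((hτ i).1 t)
    have hm' := update_mixed hτ i t
    obtain ⟨s, hs⟩ : ∃ s, 0 < pd (Function.update τ i (pureStrat t)) s := by
      by_contra hc
      push Not at hc
      have := (pd_corr hm').2
      have h2 := Finset.sum_nonpos fun s (_ : s ∈ Finset.univ) => hc s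
      linarith
    have hst : s i = t := by
      by_contra hne
      rw [pd_eq _ i, Function.update_self] at hs
      simp [pureStrat, hne] at hs
    have hs0 : pd τ s = 0 := by rw [pd_eq τ i, hst, hz, zero_mul]
    obtain ⟨y, hy, hys⟩ := farkas_game G (Pi.single s 1) (by
      intro μ h0 h1
      by_contra hc
      have hμs : 0 < μ s := by simpa [Pi.single_apply] using hc
      have hpos : 0 < ∑ s, μ s := Finset.sum_pos' (fun s _ => h0 s) ⟨s, Finset.mem_univ _, hμs⟩
      have := congrFun (hsub _ _ (normalize_ce G μ h0 hpos h1) hce) s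
      rw [hs0] at this
      have h3 : 0 < (∑ s, μ s)⁻¹ * μ s := mul_pos (inv_pos.2 hpos) hμs
      linarith)
    have hdual : IsDual G y := ⟨hy, fun s' => (hys s').trans (by
      rw [Pi.single_apply]; split_ifs <;> norm_num)⟩
    have h1 := tot_pd_update G y τ (hinv y hdual) i t
    have h2 : gen (y i) (devPayoff G i τ) t ≤ 0 :=
      Finset.sum_nonpos fun t' _ =>
        mul_nonpos_of_nonneg_of_nonpos (hy i t t') (by linarith [hbr t'])
    have h3 : tot G y (pd (Function.update τ i (pureStrat t))) ≤
        - pd (Function.update τ i (pureStrat t)) s := by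
      rw [tot_single]
      calc _ ≤ ∑ s', pd (Function.update τ i (pureStrat t)) s' * -(Pi.single s 1 : Strat m → ℝ) s' :=
            Finset.sum_le_sum fun s' _ => mul_le_mul_of_nonneg_left (hys s') (pd_nonneg hm' s')
        _ = _ := by simp [Pi.single_apply]
    linarith
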